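/- Assume A and C, assume that the functions c_i^ℓ are bounded for each i ∈ N and ℓ ∈ L, and assume η(x) > 0 for all x ∈ X. Then, for each player i ∈ N, the correspondence φ_{-i} ↦ Δ_i(φ_{-i}) ∩ Φ_i from Φ_{-i} = ∏_{j≠i} Φ_j to Φ_i is lower semicontinuous: if φ^m_{-i} → φ_{-i} in Φ_{-i} and γ_i ∈ Δ_i(φ_{-i}) ∩ Φ_i, then there exist γ_i^m ∈ Δ_i(φ^m_{-i}) ∩ Φ_i with γ_i^m → γ_i in Φ_i. -/

import Mathlib

open MeasureTheory ProbabilityTheory Filter Topology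
open scoped ENNReal NNReal

namespace CSGame

/-- The joint action space of the players. -/
abbrev JA {n : ℕ} (A : Fin n → Type) : Type := (i : Fin n) → A i

/-- The data of a constrained discounted stochastic Markov game:
countable state space `X`, Borel action spaces `A i` with compact admissible
action sets `As i x`, transition probability `p`, initial distribution `η`,
discount factor `α`, cost/constraint functions `c i ℓ` (`ℓ = 0` is the cost,
`ℓ ∈ L = {1,…,l}` are the constraints) and constraint bounds `κ i ℓ`. -/
structure GameData (n l : ℕ) (X : Type) (A : Fin n → Type)
    [MeasurableSpace X] [∀ i, MeasurableSpace (A i)] [∀ i, TopologicalSpace (A i)] where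
  As : (i : Fin n) → X → Set (A i)
  p : X → JA A → Measure X
  η : Measure X
  α : ℝ
  c : Fin n → Fin (l + 1) → X → JA A → ℝ
  κ : Fin n → Fin (l + 1) → ℝ
  hAs_ne : ∀ i x, (As i x).Nonempty
  hAs_cpt : ∀ i x, IsCompact (As i x)
  hp : ∀ x a, IsProbabilityMeasure (p x a)
  hpm : ∀ x y, Measurable fun a => p x a {y}
  hη : IsProbabilityMeasure η
  hα0 : 0 < α
  hα1 : α < 1
  hc : ∀ i ℓ x, Measurable (c i ℓ x)

variable {n l : ℕ}
variable {X : Type} [Countable X] [MeasurableSpace X] [DiscreteMeasurableSpace X]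
  [TopologicalSpace X] [DiscreteTopology X] [BorelSpace X] [SecondCountableTopology X]
variable {A : Fin n → Type} [∀ i, MeasurableSpace (A i)] [∀ i, TopologicalSpace (A i)]
  [∀ i, PolishSpace (A i)] [∀ i, BorelSpace (A i)]

/-- The set of feasible action profiles in state `x` (the section of `𝕂` at `x`). -/
def jointSet (G : GameData n l X A) (x : X) : Set (JA A) :=
  Set.univ.pi fun i => G.As i x

/-- Histories of the game: `Hist X AA t` records the initial state and `t`
state-action transitions, ending with the current state (this is `H^{t+1}`). -/
def Hist (X AA : Type) : ℕ → Type
  | 0 => X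
  | t + 1 => Hist X AA t × AA × X

noncomputable instance histMS (X AA : Type) [MeasurableSpace X] [MeasurableSpace AA] :
    ∀ t, MeasurableSpace (Hist X AA t)
  | 0 => inferInstanceAs (MeasurableSpace X)
  | t + 1 =>
      letI := histMS X AA t
      inferInstanceAs (MeasurableSpace (Hist X AA t × AA × X))

/-- The current (last) state of a history. -/
def lastState (X AA : Type) : ∀ t, Hist X AA t → X
  | 0, h => h
  | _ + 1, h => h.2.2

theorem measurable_lastState (X AA : Type) [MeasurableSpace X] [MeasurableSpace AA] :
    ∀ t, Measurable (lastState X AA t)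
  | 0 => measurable_id
  | _ + 1 => measurable_snd.comp measurable_snd

variable (G : GameData n l X A)

/-- A (history dependent, randomised) strategy of player `i`: a sequence of
transition probabilities from histories to the action space of player `i`,
concentrated on the admissible action set at the current state. -/
structure Strategy (i : Fin n) where
  f : ∀ t, Hist X (JA A) t → ProbabilityMeasure (A i)
  meas : ∀ t (s : Set (A i)), MeasurableSet s →
    Measurable fun h => (f t h : Measure (A i)) s
  supp : ∀ t h, f t h (G.As i (lastState X (JA A) t h)) = 1

/-- A stationary strategy of player `i`: a transition probability from states to
actions, concentrated on the admissible action set. -/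
def Stat (i : Fin n) : Type :=
  {φ : X → ProbabilityMeasure (A i) // ∀ x, φ x (G.As i x) = 1}

noncomputable instance (i : Fin n) : TopologicalSpace (Stat G i) :=
  inferInstanceAs (TopologicalSpace
    {φ : X → ProbabilityMeasure (A i) // ∀ x, φ x (G.As i x) = 1})

/-- Multi-strategies: one strategy for each player. -/
abbrev MultiStrategy : Type _ := ∀ i, Strategy G i

/-- Stationary multi-strategies (the set `Φ`). -/
abbrev StatProfile : Type _ := ∀ i, Stat G i

noncomputable instance : TopologicalSpace (StatProfile G) :=
  inferInstanceAs (TopologicalSpace (∀ i, Stat G i))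

/-- The strategy induced by a stationary strategy. -/
noncomputable def ofStat (i : Fin n) (φ : Stat G i) : Strategy G i where
  f := fun t h => φ.1 (lastState X (JA A) t h)
  meas := fun t _s _hs =>
    (Measurable.of_discrete (f := fun x => (φ.1 x : Measure (A i)) _s)).comp
      (measurable_lastState X (JA A) t)
  supp := fun t h => φ.2 _

/-- The multi-strategy induced by a stationary multi-strategy. -/
noncomputable def ofStatAll (φ : StatProfile G) : MultiStrategy G :=
  fun i => ofStat G i (φ i)

/-- `[π_{-i}, σ]` : player `i` deviates to `σ`, the others keep `π`. -/
noncomputable def combine (π : MultiStrategy G) (i : Fin n) (σ : Strategy G i) :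
    MultiStrategy G :=
  Function.update π i σ

/-- `[φ_{-i}, γ]` for stationary profiles. -/
noncomputable def updStat (φ : StatProfile G) (i : Fin n) (γ : Stat G i) :
    StatProfile G :=
  Function.update φ i γ

/-- The joint (product) distribution of the players' actions after history `h`. -/
noncomputable def jointLaw (π : MultiStrategy G) (t : ℕ) (h : Hist X (JA A) t) :
    Measure (JA A) :=
  Measure.pi fun i => ((π i).f t h : Measure (A i))

/-- The distribution of histories of length `t` under the multi-strategy `π`,
the transition probability `G.p` and the initial distribution `η'`
(the finite-dimensional marginals of the Ionescu–Tulcea measure `P^π_{η'}`). -/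
noncomputable def histMeas (η' : Measure X) (π : MultiStrategy G) :
    ∀ t, Measure (Hist X (JA A) t)
  | 0 => η'
  | t + 1 =>
      (histMeas η' π t).bind fun h =>
        (jointLaw G π t h).bind fun a =>
          (G.p (lastState X (JA A) t h) a).map fun y =>
            (show Hist X (JA A) (t + 1) from (h, a, y))

/-- Expected value of `f (x^{t+1}, a^{t+1})` under `π` (states enumerated from `1`
in the paper, from `0` here). -/
noncomputable def stageExp (η' : Measure X) (π : MultiStrategy G) (t : ℕ)
    (f : X → JA A → ℝ) : ℝ :=
  ∫ h, (∫ a, f (lastState X (JA A) t h) a ∂(jointLaw G π t h)) ∂(histMeas G η' π t)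

/-- The expected discounted cost functional
`J(π) = (1-α) E^π_{η'} [∑_{t≥1} α^{t-1} f(x^t,a^t)]`. -/
noncomputable def Jfun (η' : Measure X) (f : X → JA A → ℝ) (π : MultiStrategy G) : ℝ :=
  (1 - G.α) * ∑' t : ℕ, G.α ^ t * stageExp G η' π t f

/-- `J_i^ℓ(π)` of the paper. -/
noncomputable def J (i : Fin n) (ℓ : Fin (l + 1)) (π : MultiStrategy G) : ℝ :=
  Jfun G G.η (G.c i ℓ) π

/-- `π_i ∈ Δ_i(π_{-i})` : all constraints of player `i` are satisfied. -/
def Feas (i : Fin n) (π : MultiStrategy G) : Prop :=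
  ∀ ℓ : Fin (l + 1), ℓ ≠ 0 → J G i ℓ π ≤ G.κ i ℓ

/-- Expectation of `w(x^{t+1})` (as an extended nonnegative real). -/
noncomputable def wStateExp (η' : Measure X) (π : MultiStrategy G) (t : ℕ)
    (w : X → ℝ) : ℝ≥0∞ :=
  ∫⁻ h, ENNReal.ofReal (w (lastState X (JA A) t h)) ∂(histMeas G η' π t)

/-- Assumption A(i): continuity of the transition probability in the actions. -/
def AssumptionA1 : Prop :=
  ∀ x y, ContinuousOn (fun a => G.p x a {y}) (jointSet G x)

/-- Assumption A: continuity of the transition probability and of the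
cost/constraint functions in the actions. -/
def AssumptionA : Prop :=
  AssumptionA1 G ∧ ∀ i ℓ x, ContinuousOn (G.c i ℓ x) (jointSet G x)

/-- Assumption B for the weight function `w`: `w ≥ 1` bounds all the costs on `𝕂`,
the discounted tails `sup_π (1-α) E^π_η[∑_{t≥k} α^{t-1} w(x^t)]` vanish as `k → ∞`,
and for each stage `t` the family `{w(x^t)}` is uniformly integrable over all
multi-strategies. -/
def AssumptionB (w : X → ℝ) : Prop :=
  (∀ x, 1 ≤ w x) ∧
  (∀ i ℓ x a, a ∈ jointSet G x → |G.c i ℓ x a| ≤ w x) ∧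
  Tendsto (fun k : ℕ => ⨆ π : MultiStrategy G,
      ENNReal.ofReal (1 - G.α) *
        ∑' t : ℕ, ENNReal.ofReal G.α ^ (k + t) * wStateExp G G.η π (k + t) w)
    atTop (𝓝 0) ∧
  ∀ t : ℕ, Tendsto (fun k : ℕ => ⨆ π : MultiStrategy G,
      ∫⁻ h in {h | (k : ℝ) ≤ w (lastState X (JA A) t h)},
        ENNReal.ofReal (w (lastState X (JA A) t h)) ∂(histMeas G G.η π t))
    atTop (𝓝 0)

/-- Assumption C (Slater condition). -/
def AssumptionC : Prop :=
  ∀ (φ : StatProfile G) (i : Fin n), ∃ π : Strategy G i,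
    ∀ ℓ : Fin (l + 1), ℓ ≠ 0 → J G i ℓ (combine G (ofStatAll G φ) i π) < G.κ i ℓ

/-- Assumption D: the initial distribution charges every state. -/
def AssumptionD : Prop :=
  ∀ x : X, 0 < G.η {x}

/-- Assumption W (weighted-norm conditions of Wessels). -/
def AssumptionW (w : X → ℝ) : Prop :=
  (∀ x, 1 ≤ w x) ∧
  (∀ i ℓ x a, a ∈ jointSet G x → |G.c i ℓ x a| ≤ w x) ∧
  (∃ δ : ℝ, 1 ≤ δ ∧ δ * G.α < 1 ∧ ∀ x a, a ∈ jointSet G x →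
      ∫⁻ y, ENNReal.ofReal (w y) ∂(G.p x a) ≤ ENNReal.ofReal (δ * w x)) ∧
  (∀ x, ContinuousOn (fun a => ∫⁻ y, ENNReal.ofReal (w y) ∂(G.p x a)) (jointSet G x)) ∧
  (∫⁻ y, ENNReal.ofReal (w y) ∂G.η) < ⊤

/-- All cost and constraint functions are bounded. -/
def BoundedCosts : Prop :=
  ∀ i (ℓ : Fin (l + 1)), ∃ C : ℝ, ∀ x a, |G.c i ℓ x a| ≤ C

/-- A stationary multi-strategy `φ` is a Nash equilibrium of the constrained game:
it is feasible, and no player can lower his discounted cost by a unilateral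
deviation to any (history dependent) strategy satisfying his constraints. -/
def IsNashStat (φ : StatProfile G) : Prop :=
  (∀ i, Feas G i (ofStatAll G φ)) ∧
  ∀ (i : Fin n) (σ : Strategy G i), Feas G i (combine G (ofStatAll G φ) i σ) →
    J G i 0 (ofStatAll G φ) ≤ J G i 0 (combine G (ofStatAll G φ) i σ)

section Occupation

/-- A correlated strategy of the players. -/
structure CorrStrategy where
  f : ∀ t, Hist X (JA A) t → ProbabilityMeasure (JA A)
  meas : ∀ t (s : Set (JA A)), MeasurableSet s →
    Measurable fun h => (f t h : Measure (JA A)) s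
  supp : ∀ t h, f t h (jointSet G (lastState X (JA A) t h)) = 1

/-- History distributions under a correlated strategy. -/
noncomputable def histMeasC (π : CorrStrategy G) : ∀ t, Measure (Hist X (JA A) t)
  | 0 => G.η
  | t + 1 =>
      (histMeasC π t).bind fun h =>
        ((π.f t h : Measure (JA A))).bind fun a =>
          (G.p (lastState X (JA A) t h) a).map fun y =>
            (show Hist X (JA A) (t + 1) from (h, a, y))

/-- The occupation measure `ρ(K') = (1-α) E^π_η [∑_{t≥1} α^{t-1} 1_{K'}(x^t,a^t)]`
of a correlated strategy, as a measure on the state–action pairs. -/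
noncomputable def occ (π : CorrStrategy G) : Measure (X × JA A) :=
  ENNReal.ofReal (1 - G.α) •
    Measure.sum fun t : ℕ => ENNReal.ofReal G.α ^ t •
      ((histMeasC G π t).bind fun h =>
        (π.f t h : Measure (JA A)).map fun a => (lastState X (JA A) t h, a))

/-- The set `𝓜` of occupation measures of correlated strategies. -/
def OccSet : Set (ProbabilityMeasure (X × JA A)) :=
  {ρ | ∃ π : CorrStrategy G, (ρ : Measure (X × JA A)) = occ G π}

/-- Projection of a state–action pair onto the coordinates of player `i`. -/
def projAct (i : Fin n) : X × JA A → X × A i := fun q => (q.1, q.2 i)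

/-- The set `𝓜_i` of statewise projections of occupation measures onto `𝕂_i`. -/
def MiSet (i : Fin n) : Set (ProbabilityMeasure (X × A i)) :=
  {μ | ∃ ρ ∈ OccSet G, (μ : Measure (X × A i)) = (ρ : Measure (X × JA A)).map (projAct i)}

/-- The marginal `μ̂(x) = μ({x} × A_i(x))`. -/
noncomputable def marg (i : Fin n) (μ : ProbabilityMeasure (X × A i)) (x : X) : ℝ≥0∞ :=
  (μ : Measure (X × A i)) ({x} ×ˢ G.As i x)

/-- `μ = μ̂ φ` : `φ` disintegrates `μ`, i.e. `μ({x} × B) = φ(B|x) μ̂(x)`. -/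
def Disint (i : Fin n) (μ : ProbabilityMeasure (X × A i)) (φ : Stat G i) : Prop :=
  ∀ x (B : Set (A i)), MeasurableSet B → B ⊆ G.As i x →
    (μ : Measure (X × A i)) ({x} ×ˢ B) = (φ.1 x B : ℝ≥0∞) * marg G i μ x

/-- The occupation measure on state–action pairs of a multi-strategy. -/
noncomputable def occMulti (η' : Measure X) (π : MultiStrategy G) : Measure (X × JA A) :=
  ENNReal.ofReal (1 - G.α) •
    Measure.sum fun t : ℕ => ENNReal.ofReal G.α ^ t •
      ((histMeas G η' π t).bind fun h =>
        (jointLaw G π t h).map fun a => (lastState X (JA A) t h, a))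

end Occupation

section COP

/-- The product distribution on action profiles in state `x` in which player `i`
plays the fixed action `ai` and every player `j ≠ i` plays `φ j`. -/
noncomputable def statJoint (φ : StatProfile G) (i : Fin n) (x : X) (ai : A i) :
    Measure (JA A) :=
  Measure.pi fun j =>
    if h : j = i then Measure.dirac (cast (congrArg A h.symm) ai)
    else ((φ j).1 x : Measure (A j))

/-- `c_i^ℓ(x, [φ_{-i}(x), a_i])`. -/
noncomputable def cbar (φ : StatProfile G) (i : Fin n) (ℓ : Fin (l + 1)) (x : X)
    (ai : A i) : ℝ :=
  ∫ a, G.c i ℓ x a ∂(statJoint G φ i x ai)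

/-- `p(y | x, [φ_{-i}(x), a_i])`. -/
noncomputable def pbar (φ : StatProfile G) (i : Fin n) (y x : X) (ai : A i) : ℝ≥0∞ :=
  ∫⁻ a, G.p x a {y} ∂(statJoint G φ i x ai)

/-- Feasibility in the constrained optimisation problem `COP(φ_{-i})`:
`μ ∈ Pr(𝕂_i)` satisfies the constraint inequalities and the characteristic
equations of occupation measures. -/
def COPFeasible (φ : StatProfile G) (i : Fin n)
    (μ : ProbabilityMeasure (X × A i)) : Prop :=
  (μ : Measure (X × A i)) {q : X × A i | q.2 ∈ G.As i q.1} = 1 ∧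
  (∀ ℓ : Fin (l + 1), ℓ ≠ 0 →
    ∫ q : X × A i, cbar G φ i ℓ q.1 q.2 ∂(μ : Measure (X × A i)) ≤ G.κ i ℓ) ∧
  ∀ x : X, (μ : Measure (X × A i)) ({x} ×ˢ G.As i x) =
    ENNReal.ofReal (1 - G.α) * G.η {x} +
      ENNReal.ofReal G.α *
        ∫⁻ q : X × A i, pbar G φ i x q.1 q.2 ∂(μ : Measure (X × A i))

/-- The objective of `COP(φ_{-i})`. -/
noncomputable def COPObj (φ : StatProfile G) (i : Fin n)
    (μ : ProbabilityMeasure (X × A i)) : ℝ :=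
  ∫ q : X × A i, cbar G φ i 0 q.1 q.2 ∂(μ : Measure (X × A i))

/-- The solution set `𝓞_i(φ_{-i})` of `COP(φ_{-i})`. -/
def COPSol (φ : StatProfile G) (i : Fin n) : Set (ProbabilityMeasure (X × A i)) :=
  {μ | COPFeasible G φ i μ ∧
    ∀ ν, COPFeasible G φ i ν → COPObj G φ i μ ≤ COPObj G φ i ν}

end COP

section Perturbed

/-- `η̃` is a probability measure charging exactly the `η`-null states `X_0`. -/
def IsPerturb (ηt : Measure X) : Prop :=
  IsProbabilityMeasure ηt ∧ (∀ x, G.η {x} = 0 → 0 < ηt {x}) ∧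
    ∀ x, G.η {x} ≠ 0 → ηt {x} = 0

/-- The perturbed initial distribution `η(m) = (1 - 1/m) η + (1/m) η̃`. -/
noncomputable def etam (ηt : Measure X) (m : ℕ) : Measure X :=
  ENNReal.ofReal (1 - 1 / (m : ℝ)) • G.η + ENNReal.ofReal (1 / (m : ℝ)) • ηt

/-- The truncation `c_i^{ℓ,m}` of `c_i^ℓ` at the level `√m`. -/
noncomputable def ctrunc (i : Fin n) (ℓ : Fin (l + 1)) (m : ℕ) (x : X) (a : JA A) : ℝ :=
  max (-Real.sqrt m) (min (G.c i ℓ x a) (Real.sqrt m))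

/-- `J_i^{ℓ,η(m)}`: discounted cost with truncated costs and perturbed initial
distribution. -/
noncomputable def Jm (ηt : Measure X) (m : ℕ) (i : Fin n) (ℓ : Fin (l + 1))
    (π : MultiStrategy G) : ℝ :=
  Jfun G (etam G ηt m) (ctrunc G i ℓ m) π

/-- The perturbed constraint bounds `κ_i^{ℓ,m} = (1 - 1/m) κ_i^ℓ + 1/√m`. -/
noncomputable def kappam (i : Fin n) (ℓ : Fin (l + 1)) (m : ℕ) : ℝ :=
  (1 - 1 / (m : ℝ)) * G.κ i ℓ + 1 / Real.sqrt m

/-- `π_i ∈ Δ_i^m(π_{-i})` : the constraints of the `m`-CSG hold. -/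
def FeasM (ηt : Measure X) (m : ℕ) (i : Fin n) (π : MultiStrategy G) : Prop :=
  ∀ ℓ : Fin (l + 1), ℓ ≠ 0 → Jm G ηt m i ℓ π ≤ kappam G i ℓ m

end Perturbed

end CSGame

set_option linter.unusedSectionVars false

open CSGame

namespace CSGame

variable {n l : ℕ}
variable {X : Type} [Countable X] [MeasurableSpace X] [DiscreteMeasurableSpace X]
  [TopologicalSpace X] [DiscreteTopology X] [BorelSpace X] [SecondCountableTopology X]
variable {A : Fin n → Type} [∀ i, MeasurableSpace (A i)] [∀ i, TopologicalSpace (A i)]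
  [∀ i, PolishSpace (A i)] [∀ i, BorelSpace (A i)]
variable (G : GameData n l X A)

theorem pi_update_eq (i : Fin n) (μ : ∀ j, Measure (A j)) [∀ j, IsProbabilityMeasure (μ j)]
    (ν : ∀ j, Measure (A j)) [∀ j, IsProbabilityMeasure (ν j)] (h : ∀ j, j ≠ i → μ j = ν j) :
    Measure.pi ν = ((Measure.pi μ).prod (ν i)).map
      (fun q : JA A × A i => Function.update q.1 i q.2) := by
  apply Measure.pi_eq
  intro s hs
  rw [Measure.map_apply measurable_update' (MeasurableSet.univ_pi hs)]
  have : (fun q : JA A × A i => Function.update q.1 i q.2) ⁻¹' (Set.univ.pi s)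
      = (Set.univ.pi (Function.update s i Set.univ)) ×ˢ (s i) := by
    ext q
    simp only [Set.mem_preimage, Set.mem_univ_pi, Set.mem_prod]
    constructor
    · intro hq
      refine ⟨fun j => ?_, by simpa using hq i⟩
      by_cases hj : j = i
      · subst hj; simp
      · have := hq j
        simpa [hj] using this
    · rintro ⟨h1, h2⟩ j
      by_cases hj : j = i
      · subst hj; simpa using h2
      · simpa [hj] using h1 j
  rw [this, Measure.prod_prod, Measure.pi_pi]
  rw [← Finset.mul_prod_erase Finset.univ (fun j => ν j (s j)) (Finset.mem_univ i),
    ← Finset.mul_prod_erase Finset.univ _ (Finset.mem_univ i), mul_comm]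
  simp only [Function.update_self, measure_univ, one_mul]
  congr 1
  apply Finset.prod_congr rfl
  intro j hj
  have hne : j ≠ i := Finset.ne_of_mem_erase hj
  rw [Function.update_of_ne hne, h j hne]

/-- the product law of a stationary profile -/
noncomputable def piK (φ : StatProfile G) : Kernel X (JA A) where
  toFun x := Measure.pi fun j => ((φ j).1 x : Measure (A j))
  measurable' := Measurable.of_discrete

instance (φ : StatProfile G) : IsMarkovKernel (piK G φ) :=
  ⟨fun x => by unfold piK; exact inferInstanceAs (IsProbabilityMeasure (Measure.pi _))⟩

/-- transition kernel -/
noncomputable def pK : Kernel (X × JA A) X where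
  toFun q := G.p q.1 q.2
  measurable' := by
    apply measurable_from_prod_countable_right
    intro x
    apply Measure.measurable_of_measurable_coe
    intro s _
    have : (fun a => (G.p x a) s) = fun a => ∑' y : s, G.p x a {(y : X)} := by
      funext a
      rw [← Measure.tsum_indicator_apply_singleton _ _ (MeasurableSet.of_discrete), tsum_subtype s (fun y => G.p x a {y})]
    show Measurable (fun a => (G.p x a) s)
    rw [this]
    exact Measurable.tsum fun y => G.hpm x y

instance : IsMarkovKernel (pK G) := ⟨fun q => G.hp q.1 q.2⟩

/-- `(x,b) ↦` law of `(x, [φ_{-i}, b])`. -/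
noncomputable def WK (φ : StatProfile G) (i : Fin n) : Kernel (X × A i) (X × JA A) :=
  (Kernel.id ×ₖ Kernel.prodMkRight (A i) (piK G φ)).map
    (fun q : (X × A i) × JA A => (q.1.1, Function.update q.2 i q.1.2))

theorem WK_meas (i : Fin n) : Measurable
    (fun q : (X × A i) × JA A => ((q.1.1, Function.update q.2 i q.1.2) : X × JA A)) := by
  apply Measurable.prodMk (measurable_fst.comp measurable_fst)
  exact measurable_update'.comp (measurable_snd.prodMk (measurable_snd.comp measurable_fst))

instance (φ : StatProfile G) (i : Fin n) : IsMarkovKernel (WK G φ i) :=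
  Kernel.IsMarkovKernel.map _ (WK_meas i)

theorem lintegral_WK (φ : StatProfile G) (i : Fin n) (q : X × A i) {g : X × JA A → ℝ≥0∞}
    (hg : Measurable g) :
    ∫⁻ z, g z ∂(WK G φ i q) = ∫⁻ a, g (q.1, Function.update a i q.2) ∂(piK G φ q.1) := by
  unfold WK
  rw [Kernel.lintegral_map _ (WK_meas i) _ hg, Kernel.lintegral_id_prod (f := fun q : (X × A i) × JA A => g (q.1.1, Function.update q.2 i q.1.2))
      (hg.comp (WK_meas i))]
  rfl

noncomputable def strK {i : Fin n} (τ : Strategy G i) (t : ℕ) : Kernel (Hist X (JA A) t) (A i) where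
  toFun h := τ.f t h
  measurable' := Measure.measurable_of_measurable_coe _ (τ.meas t)

instance {i : Fin n} (τ : Strategy G i) (t : ℕ) : IsMarkovKernel (strK G τ t) :=
  ⟨fun h => inferInstanceAs (IsProbabilityMeasure (τ.f t h : Measure (A i)))⟩

noncomputable def lK {i : Fin n} (τ : Strategy G i) (t : ℕ) :
    Kernel (Hist X (JA A) t) (X × A i) :=
  Kernel.deterministic (lastState X (JA A) t) (measurable_lastState X (JA A) t) ×ₖ strK G τ t

instance {i : Fin n} (τ : Strategy G i) (t : ℕ) : IsMarkovKernel (lK G τ t) := by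
  unfold lK; infer_instance

theorem lintegral_lK {i : Fin n} (τ : Strategy G i) (t : ℕ) (h : Hist X (JA A) t)
    {g : X × A i → ℝ≥0∞} (hg : Measurable g) :
    ∫⁻ z, g z ∂(lK G τ t h) = ∫⁻ b, g (lastState X (JA A) t h, b) ∂(strK G τ t h) := by
  unfold lK
  rw [Kernel.lintegral_deterministic_prod _ _ _ hg]

/-- joint law kernel, on state-action pairs -/
noncomputable def xaK (φ : StatProfile G) {i : Fin n} (τ : Strategy G i) (t : ℕ) :
    Kernel (Hist X (JA A) t) (X × JA A) := WK G φ i ∘ₖ lK G τ t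

instance (φ : StatProfile G) {i : Fin n} (τ : Strategy G i) (t : ℕ) :
    IsMarkovKernel (xaK G φ τ t) := by
  unfold xaK; infer_instance

theorem jointLaw_prob (π : MultiStrategy G) (t : ℕ) (h : Hist X (JA A) t) :
    IsProbabilityMeasure (jointLaw G π t h) := by
  unfold jointLaw; infer_instance

theorem jointLaw_combine (φ : StatProfile G) {i : Fin n} (τ : Strategy G i) (t : ℕ)
    (h : Hist X (JA A) t) :
    jointLaw G (combine G (ofStatAll G φ) i τ) t h =
      ((piK G φ (lastState X (JA A) t h)).prod (strK G τ t h)).map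
      (fun q : JA A × A i => Function.update q.1 i q.2) := by
  unfold jointLaw
  have key := pi_update_eq (A := A) i (fun j => ((φ j).1 (lastState X (JA A) t h) : Measure (A j)))
    (fun j => (((combine G (ofStatAll G φ) i τ) j).f t h : Measure (A j))) (by
      intro j hj
      simp [combine, Function.update_of_ne hj, ofStatAll, ofStat])
  rw [key]
  simp only [combine, Function.update_self]
  rfl

theorem xaK_eq (φ : StatProfile G) {i : Fin n} (τ : Strategy G i) (t : ℕ)
    (h : Hist X (JA A) t) :
    xaK G φ τ t h = (jointLaw G (combine G (ofStatAll G φ) i τ) t h).map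
      (Prod.mk (lastState X (JA A) t h)) := by
  apply Measure.ext_of_lintegral
  intro g hg
  have h0 : Measurable fun a => g (lastState X (JA A) t h, a) :=
    hg.comp measurable_prodMk_left
  rw [lintegral_map hg measurable_prodMk_left, jointLaw_combine,
    lintegral_map h0 measurable_update', lintegral_prod_symm]
  · unfold xaK
    rw [Kernel.lintegral_comp _ _ _ hg]
    simp_rw [lintegral_WK G φ i _ hg]
    rw [lintegral_lK]
    apply Measurable.lintegral_kernel_prod_right'  (κ := Kernel.prodMkRight (A i) (piK G φ))
      (f := fun q : (X × A i) × JA A => g ((q.1.1, Function.update q.2 i q.1.2) : X × JA A))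
    exact hg.comp (WK_meas i)
  · exact (h0.comp measurable_update').aemeasurable

noncomputable def jointK (φ : StatProfile G) {i : Fin n} (τ : Strategy G i) (t : ℕ) :
    Kernel (Hist X (JA A) t) (JA A) := (xaK G φ τ t).map Prod.snd

instance (φ : StatProfile G) {i : Fin n} (τ : Strategy G i) (t : ℕ) :
    IsMarkovKernel (jointK G φ τ t) := Kernel.IsMarkovKernel.map _ measurable_snd

theorem jointK_apply (φ : StatProfile G) {i : Fin n} (τ : Strategy G i) (t : ℕ)
    (h : Hist X (JA A) t) :
    jointK G φ τ t h = jointLaw G (combine G (ofStatAll G φ) i τ) t h := by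
  unfold jointK
  rw [Kernel.map_apply _ measurable_snd, xaK_eq, Measure.map_map measurable_snd measurable_prodMk_left]
  exact Measure.map_id

/-- one-step history kernel -/
noncomputable def stepK (φ : StatProfile G) {i : Fin n} (τ : Strategy G i) (t : ℕ) :
    Kernel (Hist X (JA A) t) (Hist X (JA A) t × JA A × X) :=
  Kernel.id ×ₖ (jointK G φ τ t ⊗ₖ (pK G).comap
    (fun q : Hist X (JA A) t × JA A => (lastState X (JA A) t q.1, q.2))
    (((measurable_lastState X (JA A) t).comp measurable_fst).prodMk measurable_snd))

instance (φ : StatProfile G) {i : Fin n} (τ : Strategy G i) (t : ℕ) :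
    IsMarkovKernel (stepK G φ τ t) := by unfold stepK; infer_instance

theorem lintegral_stepK (φ : StatProfile G) {i : Fin n} (τ : Strategy G i) (t : ℕ)
    (h : Hist X (JA A) t) {g : Hist X (JA A) t × JA A × X → ℝ≥0∞} (hg : Measurable g) :
    ∫⁻ z, g z ∂(stepK G φ τ t h) =
      ∫⁻ a, ∫⁻ y, g (h, a, y) ∂(G.p (lastState X (JA A) t h) a)
        ∂(jointLaw G (combine G (ofStatAll G φ) i τ) t h) := by
  unfold stepK
  rw [Kernel.lintegral_id_prod hg, Kernel.lintegral_compProd, jointK_apply]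
  · rfl
  · exact hg.comp measurable_prodMk_left

theorem stepK_apply (φ : StatProfile G) {i : Fin n} (τ : Strategy G i) (t : ℕ)
    (h : Hist X (JA A) t) :
    stepK G φ τ t h = (jointLaw G (combine G (ofStatAll G φ) i τ) t h).bind fun a =>
          (G.p (lastState X (JA A) t h) a).map fun y => (h, a, y) := by
  have hm : ∀ a : JA A, Measurable fun y : X => (h, a, y) := fun a => Measurable.of_discrete
  apply Measure.ext_of_lintegral
  intro g hg
  have hmm : Measurable fun a => (G.p (lastState X (JA A) t h) a).map fun y => (h, a, y) := by
    apply Measure.measurable_of_measurable_coe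
    intro s hs
    simp_rw [Measure.map_apply (hm _) hs]
    exact Kernel.measurable_kernel_prodMk_left (κ := (pK G).comap
      (fun a : JA A => (lastState X (JA A) t h, a)) measurable_prodMk_left)
      (t := Prod.mk h ⁻¹' s) (measurable_prodMk_left hs)
  rw [lintegral_stepK G φ τ t h hg, Measure.lintegral_bind hmm.aemeasurable hg.aemeasurable]
  simp_rw [lintegral_map hg (hm _)]

theorem histMeas_succ (φ : StatProfile G) {i : Fin n} (τ : Strategy G i) (t : ℕ) :
    histMeas G G.η (combine G (ofStatAll G φ) i τ) (t + 1) =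
      (histMeas G G.η (combine G (ofStatAll G φ) i τ) t).bind (stepK G φ τ t) := by
  rw [histMeas]
  congr 1
  funext h
  exact (stepK_apply G φ τ t h).symm

theorem histMeas_prob (φ : StatProfile G) {i : Fin n} (τ : Strategy G i) (t : ℕ) :
    IsProbabilityMeasure (histMeas G G.η (combine G (ofStatAll G φ) i τ) t) := by
  induction t with
  | zero => exact G.hη
  | succ t ih =>
    rw [histMeas_succ]
    exact inferInstanceAs (IsProbabilityMeasure (Measure.bind (histMeas G G.η (combine G (ofStatAll G φ) i τ) t) (stepK G φ τ t)))

/-- law of `(x^t, a_i^t)` -/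
noncomputable def SM (φ : StatProfile G) {i : Fin n} (τ : Strategy G i) (t : ℕ) :
    Measure (X × A i) :=
  (histMeas G G.η (combine G (ofStatAll G φ) i τ) t).bind (lK G τ t)

instance (φ : StatProfile G) {i : Fin n} (τ : Strategy G i) (t : ℕ) :
    IsProbabilityMeasure (SM G φ τ t) := by
  have := histMeas_prob G φ τ t
  unfold SM; infer_instance

theorem SM_map_fst (φ : StatProfile G) {i : Fin n} (τ : Strategy G i) (t : ℕ) :
    (SM G φ τ t).map Prod.fst =
      (histMeas G G.η (combine G (ofStatAll G φ) i τ) t).map (lastState X (JA A) t) := by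
  apply Measure.ext_of_lintegral
  intro g hg
  rw [lintegral_map hg measurable_fst, lintegral_map hg (measurable_lastState X (JA A) t)]
  unfold SM
  have hg1 : Measurable fun q : X × A i => g q.1 := hg.comp measurable_fst
  rw [Measure.lintegral_bind (lK G τ t).measurable.aemeasurable hg1.aemeasurable]
  simp_rw [lintegral_lK G τ t _ hg1]
  simp

theorem SM_zero (φ : StatProfile G) {i : Fin n} (τ : Strategy G i) :
    (SM G φ τ 0).map Prod.fst = G.η := by
  rw [SM_map_fst]
  exact Measure.map_id

theorem WSM_eq (φ : StatProfile G) {i : Fin n} (τ : Strategy G i) (t : ℕ) :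
    (SM G φ τ t).bind (WK G φ i) =
      (histMeas G G.η (combine G (ofStatAll G φ) i τ) t).bind (xaK G φ τ t) := by
  unfold SM xaK
  rw [Measure.comp_assoc]

theorem SM_succ (φ : StatProfile G) {i : Fin n} (τ : Strategy G i) (t : ℕ) :
    (SM G φ τ (t+1)).map Prod.fst = ((SM G φ τ t).bind (WK G φ i)).bind (pK G) := by
  rw [SM_map_fst, WSM_eq]
  apply Measure.ext_of_lintegral
  intro g hg
  have hl := measurable_lastState X (JA A) (t+1)
  have hgl : Measurable fun z : Hist X (JA A) t × JA A × X => g z.2.2 :=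
    hg.comp (measurable_snd.comp measurable_snd)
  rw [lintegral_map hg hl, Measure.lintegral_bind (pK G).measurable.aemeasurable hg.aemeasurable,
    Measure.lintegral_bind (xaK G φ τ t).measurable.aemeasurable hg.lintegral_kernel.aemeasurable]
  rw [histMeas_succ]
  refine (Measure.lintegral_bind (stepK G φ τ t).measurable.aemeasurable hgl.aemeasurable).trans ?_
  apply lintegral_congr
  intro h
  rw [lintegral_stepK G φ τ t h hgl, xaK_eq, lintegral_map hg.lintegral_kernel measurable_prodMk_left]
  rfl

theorem integral_bind_kernel {α β : Type*} [MeasurableSpace α] [MeasurableSpace β] (μ : Measure α)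
    (κ : Kernel α β) {f : β → ℝ} (hf : Integrable f (μ.bind κ)) :
    ∫ y, f y ∂(μ.bind κ) = ∫ x, ∫ y, f y ∂(κ x) ∂μ := by
  have h : μ.bind κ = (κ ∘ₖ Kernel.const Unit μ) () := by
    rw [Measure.comp_eq_comp_const_apply]
  rw [h] at hf ⊢
  rw [Kernel.integral_comp hf]
  simp

theorem integrable_bdd {α : Type*} [MeasurableSpace α] (μ : Measure α) [IsFiniteMeasure μ]
    {f : α → ℝ} (hf : Measurable f) {C : ℝ} (hC : ∀ x, |f x| ≤ C) : Integrable f μ :=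
  Integrable.of_bound hf.aestronglyMeasurable C (ae_of_all _ hC)

theorem stageExp_eq (φ : StatProfile G) {i : Fin n} (τ : Strategy G i) (t : ℕ)
    {f : X → JA A → ℝ} (hf : ∀ x, Measurable (f x)) {C : ℝ} (hC : ∀ x a, |f x a| ≤ C) :
    stageExp G G.η (combine G (ofStatAll G φ) i τ) t f =
      ∫ q, f q.1 q.2 ∂((SM G φ τ t).bind (WK G φ i)) := by
  have hm : Measurable fun q : X × JA A => f q.1 q.2 := measurable_from_prod_countable_right hf
  rw [integral_bind_kernel _ _ (integrable_bdd _ hm (fun q => hC q.1 q.2))] 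
  have := histMeas_prob G φ τ t
  rw [← integral_bind_kernel _ _ (integrable_bdd _ hm (fun q => hC q.1 q.2)), WSM_eq,
    integral_bind_kernel _ _ (integrable_bdd _ hm (fun q => hC q.1 q.2))]
  unfold stageExp
  congr 1
  funext h
  rw [xaK_eq, integral_map measurable_prodMk_left.aemeasurable hm.aestronglyMeasurable]

/-- discounted occupation measure of `(x, a_i)` -/
noncomputable def occ2 (φ : StatProfile G) {i : Fin n} (τ : Strategy G i) : Measure (X × A i) :=
  Measure.sum fun t : ℕ => ENNReal.ofReal ((1 - G.α) * G.α ^ t) • SM G φ τ t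

theorem wt_nonneg (t : ℕ) : 0 ≤ (1 - G.α) * G.α ^ t :=
  mul_nonneg (by linarith [G.hα1]) (pow_nonneg G.hα0.le t)

theorem wt_hasSum : HasSum (fun t : ℕ => (1 - G.α) * G.α ^ t) 1 := by
  have h := (hasSum_geometric_of_lt_one G.hα0.le G.hα1).mul_left (1 - G.α)
  rwa [mul_inv_cancel₀ (by linarith [G.hα1])] at h

theorem wt_tsum : ∑' t : ℕ, ENNReal.ofReal ((1 - G.α) * G.α ^ t) = 1 := by
  rw [← ENNReal.ofReal_tsum_of_nonneg (wt_nonneg G) (wt_hasSum G).summable, (wt_hasSum G).tsum_eq]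
  simp

instance occ2_prob (φ : StatProfile G) {i : Fin n} (τ : Strategy G i) :
    IsProbabilityMeasure (occ2 G φ τ) := by
  constructor
  unfold occ2
  rw [Measure.sum_apply _ MeasurableSet.univ]
  simp [wt_tsum]

theorem Jfun_eq (φ : StatProfile G) {i : Fin n} (τ : Strategy G i)
    {f : X → JA A → ℝ} (hf : ∀ x, Measurable (f x)) {C : ℝ} (hC : ∀ x a, |f x a| ≤ C) :
    Jfun G G.η f (combine G (ofStatAll G φ) i τ) =
      ∫ q, f q.1 q.2 ∂((occ2 G φ τ).bind (WK G φ i)) := by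
  have hm : Measurable fun q : X × JA A => f q.1 q.2 := measurable_from_prod_countable_right hf
  have hi := integrable_bdd ((occ2 G φ τ).bind (WK G φ i)) hm (fun q => hC q.1 q.2)
  have he : (occ2 G φ τ).bind (WK G φ i) = Measure.sum fun t : ℕ =>
      ENNReal.ofReal ((1 - G.α) * G.α ^ t) • (SM G φ τ t).bind (WK G φ i) := by
    unfold occ2
    rw [Measure.bind_sum _ _ (WK G φ i).measurable.aemeasurable]
    congr 1
    funext t
    rw [Measure.comp_smul]
  rw [he] at hi ⊢
  rw [← (hasSum_integral_measure hi).tsum_eq]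
  unfold Jfun
  rw [← tsum_mul_left]
  congr 1
  funext t
  rw [stageExp_eq G φ τ t hf hC, integral_smul_measure, ENNReal.toReal_ofReal (wt_nonneg G t),
    smul_eq_mul, mul_assoc]

theorem map_fst_occ2 (φ : StatProfile G) {i : Fin n} (τ : Strategy G i) :
    (occ2 G φ τ).map Prod.fst = Measure.sum fun t : ℕ =>
      ENNReal.ofReal ((1 - G.α) * G.α ^ t) • (SM G φ τ t).map Prod.fst := by
  unfold occ2
  rw [Measure.map_sum measurable_fst.aemeasurable]
  congr 1
  funext t
  rw [Measure.map_smul]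

theorem occ2_balance (φ : StatProfile G) {i : Fin n} (τ : Strategy G i) :
    (occ2 G φ τ).map Prod.fst = ENNReal.ofReal (1 - G.α) • G.η +
      ENNReal.ofReal G.α • ((occ2 G φ τ).bind (WK G φ i)).bind (pK G) := by
  have he : ((occ2 G φ τ).bind (WK G φ i)).bind (pK G) = Measure.sum fun t : ℕ =>
      ENNReal.ofReal ((1 - G.α) * G.α ^ t) • ((SM G φ τ t).bind (WK G φ i)).bind (pK G) := by
    unfold occ2
    rw [Measure.bind_sum _ _ (WK G φ i).measurable.aemeasurable,
      Measure.bind_sum _ _ (pK G).measurable.aemeasurable]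
    congr 1
    funext t
    rw [Measure.comp_smul, Measure.comp_smul]
  rw [he, map_fst_occ2]
  ext s hs
  rw [Measure.sum_apply _ hs, tsum_eq_zero_add' ENNReal.summable]
  simp only [Measure.smul_apply, Measure.add_apply, smul_eq_mul, Measure.sum_apply _ hs]
  rw [SM_zero, ← ENNReal.tsum_mul_left]
  congr 1
  · simp
  · congr 1
    funext t
    rw [SM_succ, ← mul_assoc, ← ENNReal.ofReal_mul G.hα0.le]
    congr 2
    ring

theorem occ2_supp (φ : StatProfile G) {i : Fin n} (τ : Strategy G i) :
    ∀ᵐ q ∂(occ2 G φ τ), q.2 ∈ G.As i q.1 := by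
  have hms : MeasurableSet {q : X × A i | q.2 ∈ G.As i q.1} := by
    have : {q : X × A i | q.2 ∈ G.As i q.1} = ⋃ x : X, {x} ×ˢ G.As i x := by
      ext q; simp
    rw [this]
    exact MeasurableSet.iUnion fun x =>
      (MeasurableSet.singleton x).prod (G.hAs_cpt i x).isClosed.measurableSet
  unfold occ2
  rw [Measure.ae_sum_iff]
  intro t
  apply Measure.ae_smul_measure
  unfold SM
  apply Measure.ae_comp_of_ae_ae hms
  refine ae_of_all _ fun h => ?_
  have h1 : lK G τ t h = (strK G τ t h).map (Prod.mk (lastState X (JA A) t h)) := by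
    apply Measure.ext_of_lintegral
    intro g hg
    rw [lintegral_lK G τ t h hg, lintegral_map hg measurable_prodMk_left]
  rw [h1, ae_map_iff measurable_prodMk_left.aemeasurable hms]
  have h2 := τ.supp t h
  have h3 : (τ.f t h : Measure (A i)) (G.As i (lastState X (JA A) t h)) = 1 := by
    rw [← ProbabilityMeasure.ennreal_coeFn_eq_coeFn_toMeasure, h2]; rfl
  exact (mem_ae_iff_prob_eq_one (G.hAs_cpt i _).isClosed.measurableSet).2 h3

/-- a stationary strategy as a kernel -/
noncomputable def statK {i : Fin n} (γ : Stat G i) : Kernel X (A i) where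
  toFun x := γ.1 x
  measurable' := Measurable.of_discrete

instance {i : Fin n} (γ : Stat G i) : IsMarkovKernel (statK G γ) :=
  ⟨fun x => inferInstanceAs (IsProbabilityMeasure (γ.1 x : Measure (A i)))⟩

theorem SM_stat (φ : StatProfile G) {i : Fin n} (γ : Stat G i) (t : ℕ) :
    SM G φ (ofStat G i γ) t = ((SM G φ (ofStat G i γ) t).map Prod.fst) ⊗ₘ statK G γ := by
  have : IsProbabilityMeasure ((SM G φ (ofStat G i γ) t).map Prod.fst) :=
    Measure.isProbabilityMeasure_map measurable_fst.aemeasurable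
  apply Measure.ext_of_lintegral
  intro g hg
  rw [Measure.lintegral_compProd hg, SM_map_fst,
    lintegral_map (hg.lintegral_kernel_prod_right') (measurable_lastState X (JA A) t)]
  unfold SM
  rw [Measure.lintegral_bind (lK G _ t).measurable.aemeasurable hg.aemeasurable]
  simp_rw [lintegral_lK G _ t _ hg]
  rfl

theorem occ2_stat (φ : StatProfile G) {i : Fin n} (γ : Stat G i) :
    occ2 G φ (ofStat G i γ) = ((occ2 G φ (ofStat G i γ)).map Prod.fst) ⊗ₘ statK G γ := by
  have : ∀ t, IsProbabilityMeasure ((SM G φ (ofStat G i γ) t).map Prod.fst) := fun t =>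
    Measure.isProbabilityMeasure_map measurable_fst.aemeasurable
  have h2 : ∀ t : ℕ, SFinite (ENNReal.ofReal ((1 - G.α) * G.α ^ t) •
    (SM G φ (ofStat G i γ) t).map Prod.fst) := fun t => inferInstance
  rw [map_fst_occ2, Measure.compProd_sum_left]
  unfold occ2
  congr 1
  funext t
  rw [Measure.compProd_smul_left, ← SM_stat]

theorem stat_exists (hη : AssumptionD G) (φ : StatProfile G) {i : Fin n} (ν : Measure (X × A i))
    [IsProbabilityMeasure ν] (hs : ∀ᵐ q ∂ν, q.2 ∈ G.As i q.1)
    (hb : ν.map Prod.fst = ENNReal.ofReal (1 - G.α) • G.η +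
      ENNReal.ofReal G.α • (ν.bind (WK G φ i)).bind (pK G)) :
    ∃ γ : Stat G i, ν = occ2 G φ (ofStat G i γ) := by
  have hp : IsProbabilityMeasure (ν.map Prod.fst) :=
    Measure.isProbabilityMeasure_map measurable_fst.aemeasurable
  have hXne : Nonempty X := by
    have := G.hη
    exact nonempty_of_isProbabilityMeasure G.η
  have hAne : Nonempty (A i) := ⟨(G.hAs_ne i hXne.some).some⟩
  have hpos : ∀ x, (ν.map Prod.fst) {x} ≠ 0 := by
    intro x
    rw [hb]
    simp only [Measure.add_apply, Measure.smul_apply, smul_eq_mul, ne_eq, add_eq_zero, not_and_or]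
    left
    exact mul_ne_zero (by simpa using G.hα1) (hη x).ne'
  have hd : (ν.map Prod.fst) ⊗ₘ ν.condKernel = ν := ν.disintegrate ν.condKernel
  have hs' : ∀ x, ∀ᵐ b ∂(ν.condKernel x), b ∈ G.As i x := by
    rw [← hd] at hs
    have h1 := Measure.ae_ae_of_ae_compProd hs
    rw [ae_iff_of_countable] at h1
    exact fun x => h1 x (hpos x)
  let γ : Stat G i := ⟨fun x => ⟨ν.condKernel x, inferInstance⟩, fun x => by
    have := (mem_ae_iff_prob_eq_one (G.hAs_cpt i x).isClosed.measurableSet).1 (hs' x)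
    rw [← ENNReal.coe_inj]
    exact (ProbabilityMeasure.ennreal_coeFn_eq_coeFn_toMeasure
      (⟨ν.condKernel x, inferInstance⟩ : ProbabilityMeasure (A i)) (G.As i x)).trans this⟩
  refine ⟨γ, ?_⟩
  have hγ : statK G γ = ν.condKernel := by ext x; rfl
  rw [← hγ] at hd
  set T : Kernel X X := pK G ∘ₖ (WK G φ i ∘ₖ (Kernel.id ×ₖ statK G γ)) with hT
  have hTm : ∀ m : Measure X, [SFinite m] → 
      ((m ⊗ₘ statK G γ).bind (WK G φ i)).bind (pK G) = m.bind T := by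
    intro m _
    rw [Measure.compProd_eq_comp_prod, Measure.comp_assoc, Measure.comp_assoc, hT, Kernel.comp_assoc]
  set m := ν.map Prod.fst with hm
  have hbm : m = ENNReal.ofReal (1 - G.α) • G.η + ENNReal.ofReal G.α • m.bind T := by
    rw [← hTm m, hd]; exact hb
  set w : ℕ → ℝ≥0∞ := fun t => ENNReal.ofReal ((1 - G.α) * G.α ^ t) with hw
  set μ : ℕ → Measure X := fun t => (SM G φ (ofStat G i γ) t).map Prod.fst with hμ
  have hμ0 : μ 0 = G.η := SM_zero G φ _
  have hμp : ∀ t, IsProbabilityMeasure (μ t) := fun t =>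
    Measure.isProbabilityMeasure_map measurable_fst.aemeasurable
  have hμs : ∀ t, μ (t + 1) = (μ t).bind T := by
    intro t
    rw [← hTm (μ t)]
    simp only [hμ]
    rw [← SM_stat, SM_succ]
  have hw0 : w 0 = ENNReal.ofReal (1 - G.α) := by simp [hw]
  have hws : ∀ t, w (t + 1) = ENNReal.ofReal G.α * w t := by
    intro t
    simp only [hw]
    rw [← ENNReal.ofReal_mul G.hα0.le]
    congr 1
    ring
  have hP : ∀ N, ∑ t ∈ Finset.range N, w t • μ t ≤ m := by
    intro N
    induction N with
    | zero => simp [Measure.zero_le]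
    | succ N ih =>
      rw [Measure.le_iff]
      intro s hs
      have h1 : (m.bind T) s ≥ ∑ t ∈ Finset.range N, w t * μ (t + 1) s := by
        rw [Measure.bind_apply hs T.measurable.aemeasurable]
        refine le_trans (le_of_eq ?_) (lintegral_mono' ih le_rfl)
        rw [lintegral_finsetSum_measure]
        apply Finset.sum_congr rfl
        intro t _
        rw [lintegral_smul_measure, hμs, Measure.bind_apply hs T.measurable.aemeasurable, smul_eq_mul]
      rw [hbm, Finset.sum_range_succ']
      simp only [Measure.add_apply, Measure.finsetSum_apply, Measure.smul_apply, smul_eq_mul]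
      rw [hμ0, hw0, add_comm]
      gcongr
      refine le_trans (le_of_eq ?_) (mul_le_mul_right h1 _)
      rw [Finset.mul_sum]
      apply Finset.sum_congr rfl
      intro t _
      rw [hws, mul_assoc]
  have hle : (occ2 G φ (ofStat G i γ)).map Prod.fst ≤ m := by
    rw [map_fst_occ2, Measure.le_iff]
    intro s hs
    rw [Measure.sum_apply _ hs]
    apply ENNReal.tsum_le_of_sum_range_le
    intro N
    have := hP N s
    simpa [Measure.finsetSum_apply, hw, hμ] using this
  have hpo : IsProbabilityMeasure ((occ2 G φ (ofStat G i γ)).map Prod.fst) :=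
    Measure.isProbabilityMeasure_map measurable_fst.aemeasurable
  have heq := Measure.eq_of_le_of_isProbabilityMeasure hle
  rw [occ2_stat, heq, hd]

theorem mix_exists (hη : AssumptionD G) (φ : StatProfile G) {i : Fin n} (τ₁ τ₂ : Strategy G i)
    {e : ℝ} (he0 : 0 ≤ e) (he1 : e ≤ 1) :
    ∃ γ : Stat G i, occ2 G φ (ofStat G i γ) =
      ENNReal.ofReal (1 - e) • occ2 G φ τ₁ + ENNReal.ofReal e • occ2 G φ τ₂ := by
  have hsum : ENNReal.ofReal (1 - e) + ENNReal.ofReal e = 1 := by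
    rw [← ENNReal.ofReal_add (by linarith) he0]; simp
  have hp : IsProbabilityMeasure
      (ENNReal.ofReal (1 - e) • occ2 G φ τ₁ + ENNReal.ofReal e • occ2 G φ τ₂) :=
    ⟨by simp [hsum]⟩
  obtain ⟨γ, hγ⟩ := stat_exists G hη φ
    (ENNReal.ofReal (1 - e) • occ2 G φ τ₁ + ENNReal.ofReal e • occ2 G φ τ₂)
    (by
      rw [ae_add_measure_iff]
      exact ⟨Measure.ae_smul_measure (occ2_supp G φ τ₁) _,
        Measure.ae_smul_measure (occ2_supp G φ τ₂) _⟩)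
    (by
      rw [Measure.map_add _ _ measurable_fst, Measure.map_smul, Measure.map_smul,
        occ2_balance, occ2_balance, Measure.comp_add, Measure.comp_add,
        Measure.comp_smul, Measure.comp_smul, Measure.comp_smul, Measure.comp_smul]
      ext s hs
      simp only [Measure.add_apply, Measure.smul_apply, smul_eq_mul]
      have h1 : G.η s = (ENNReal.ofReal (1 - e) + ENNReal.ofReal e) * G.η s := by
        rw [hsum, one_mul]
      conv_rhs => rw [h1]
      ring)
  exact ⟨γ, hγ.symm⟩

theorem stat_int (φ : StatProfile G) {i : Fin n} (γ : Stat G i) (x : X)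
    {h : A i → ℝ} (hm : Measurable h) {C : ℝ} (hC : ∀ b, |h b| ≤ C) :
    ∫ q in Prod.fst ⁻¹' {x}, h q.2 ∂(occ2 G φ (ofStat G i γ)) =
      (occ2 G φ (ofStat G i γ)).real (Prod.fst ⁻¹' {x}) * ∫ b, h b ∂(γ.1 x : Measure (A i)) := by
  have hp : IsProbabilityMeasure ((occ2 G φ (ofStat G i γ)).map Prod.fst) :=
    Measure.isProbabilityMeasure_map measurable_fst.aemeasurable
  have h1 : (occ2 G φ (ofStat G i γ)).real (Prod.fst ⁻¹' {x}) =
      ((occ2 G φ (ofStat G i γ)).map Prod.fst).real {x} := by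
    rw [map_measureReal_apply measurable_fst (MeasurableSet.singleton x)]
  rw [h1]
  conv_lhs => rw [occ2_stat]
  have h2 : (Prod.fst ⁻¹' {x} : Set (X × A i)) = {x} ×ˢ Set.univ := by ext q; simp
  have hm2 : Measurable fun q : X × A i => h q.2 := hm.comp measurable_snd
  rw [h2, Measure.setIntegral_compProd (MeasurableSet.singleton x) MeasurableSet.univ
    (integrable_bdd _ hm2 (fun q => hC q.2)).integrableOn]
  simp only [Measure.restrict_univ, Measure.restrict_singleton, integral_smul_measure,
    integral_dirac, smul_eq_mul]
  rfl

theorem occ_pos (hη : AssumptionD G) (φ : StatProfile G) {i : Fin n} (τ : Strategy G i) (x : X) :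
    0 < (occ2 G φ τ).real (Prod.fst ⁻¹' {x}) := by
  rw [← map_measureReal_apply measurable_fst (MeasurableSet.singleton x)]
  have hp : IsProbabilityMeasure ((occ2 G φ τ).map Prod.fst) :=
    Measure.isProbabilityMeasure_map measurable_fst.aemeasurable
  rw [measureReal_def]
  refine ENNReal.toReal_pos ?_ (measure_ne_top _ _)
  rw [occ2_balance]
  simp only [Measure.add_apply, Measure.smul_apply, smul_eq_mul, ne_eq, add_eq_zero, not_and_or]
  left
  exact mul_ne_zero (by simpa using G.hα1) (hη x).ne'

theorem mix_tendsto (hη : AssumptionD G) (φ : StatProfile G) {i : Fin n} (γ : Stat G i)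
    (τ : Strategy G i) (e : ℕ → ℝ) (he0 : ∀ k, 0 ≤ e k) (he1 : ∀ k, e k ≤ 1)
    (he : Tendsto e atTop (𝓝 0)) (γk : ℕ → Stat G i)
    (hk : ∀ k, occ2 G φ (ofStat G i (γk k)) = ENNReal.ofReal (1 - e k) • occ2 G φ (ofStat G i γ)
      + ENNReal.ofReal (e k) • occ2 G φ τ) :
    Tendsto γk atTop (𝓝 γ) := by
  refine tendsto_subtype_rng.2 (tendsto_pi_nhds.2 fun x => ?_)
  rw [ProbabilityMeasure.tendsto_iff_forall_integral_tendsto]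
  intro h
  have hm : Measurable h := h.continuous.measurable
  have hC : ∀ b, |h b| ≤ ‖h‖ := fun b => h.norm_coe_le_norm b
  have hm2 : Measurable fun q : X × A i => h q.2 := hm.comp measurable_snd
  set I₁ := ∫ q in Prod.fst ⁻¹' {x}, h q.2 ∂(occ2 G φ (ofStat G i γ)) with hI1
  set I₂ := ∫ q in Prod.fst ⁻¹' {x}, h q.2 ∂(occ2 G φ τ) with hI2
  set r₁ := (occ2 G φ (ofStat G i γ)).real (Prod.fst ⁻¹' {x}) with hr1
  set r₂ := (occ2 G φ τ).real (Prod.fst ⁻¹' {x}) with hr2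
  have hr1p : 0 < r₁ := occ_pos G hη φ _ x
  have hlim : ∫ b, h b ∂(γ.1 x : Measure (A i)) = ((1 - 0) * I₁ + 0 * I₂) / ((1 - 0) * r₁ + 0 * r₂) := by
    rw [hI1, stat_int G φ γ x hm hC, ← hr1]
    simp only [sub_zero, one_mul, zero_mul, add_zero]
    field_simp
  have hkint : ∀ k, ∫ b, h b ∂((γk k).1 x : Measure (A i)) =
      ((1 - e k) * I₁ + e k * I₂) / ((1 - e k) * r₁ + e k * r₂) := by
    intro k
    have hpos := occ_pos G hη φ (ofStat G i (γk k)) x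
    have h1 := stat_int G φ (γk k) x hm hC
    have hR : (occ2 G φ (ofStat G i (γk k))).real (Prod.fst ⁻¹' {x}) =
        (1 - e k) * r₁ + e k * r₂ := by
      have hfin : ∀ (c : ℝ) (τ' : Strategy G i),
          (ENNReal.ofReal c • occ2 G φ τ') (Prod.fst ⁻¹' {x}) ≠ ∞ := fun c τ' => by
        rw [Measure.smul_apply, smul_eq_mul]
        exact ENNReal.mul_ne_top ENNReal.ofReal_ne_top (measure_ne_top _ _)
      rw [hk k, measureReal_add_apply (hfin _ _) (hfin _ _), measureReal_ennreal_smul_apply, measureReal_ennreal_smul_apply,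
        ENNReal.toReal_ofReal (by linarith [he1 k]), ENNReal.toReal_ofReal (he0 k)]
    have hI : ∫ q in Prod.fst ⁻¹' {x}, h q.2 ∂(occ2 G φ (ofStat G i (γk k))) =
        (1 - e k) * I₁ + e k * I₂ := by
      rw [hk k, Measure.restrict_add, Measure.restrict_smul, Measure.restrict_smul,
        integral_add_measure, integral_smul_measure, integral_smul_measure,
        ENNReal.toReal_ofReal (by linarith [he1 k]), ENNReal.toReal_ofReal (he0 k)]
      · rfl
      · exact (integrable_bdd _ hm2 (fun q : X × A i => hC q.2)).smul_measure
          ENNReal.ofReal_ne_top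
      · exact (integrable_bdd _ hm2 (fun q : X × A i => hC q.2)).smul_measure
          ENNReal.ofReal_ne_top
    rw [hR] at h1 hpos
    rw [hI] at h1
    rw [h1]
    field_simp
  have goal : Tendsto (fun k => ∫ b, h b ∂((γk k).1 x : Measure (A i))) atTop
      (𝓝 (∫ b, h b ∂(γ.1 x : Measure (A i)))) := by
    simp_rw [hkint]
    rw [hlim]
    have h1e : Tendsto (fun k => 1 - e k) atTop (𝓝 (1 - 0)) := tendsto_const_nhds.sub he
    refine Tendsto.div ((h1e.mul_const _).add (he.mul_const _))
      ((h1e.mul_const _).add (he.mul_const _)) ?_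
    simpa using hr1p.ne'
  exact goal

theorem scheffe {ι : Type*} (u : ι → ℝ) (um : ℕ → ι → ℝ) (hu0 : ∀ x, 0 ≤ u x)
    (hum0 : ∀ m x, 0 ≤ um m x) (hu : HasSum u 1) (hum : ∀ m, HasSum (um m) 1)
    (hlim : ∀ x, Tendsto (fun m => um m x) atTop (𝓝 (u x)))
    (g : ι → ℝ) (gm : ℕ → ι → ℝ) {C : ℝ} (hgm : ∀ m x, |gm m x| ≤ C)
    (hg : ∀ x, Tendsto (fun m => gm m x) atTop (𝓝 (g x))) :
    Tendsto (fun m => ∑' x, um m x * gm m x) atTop (𝓝 (∑' x, u x * g x)) := by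
  have hC : 0 ≤ C := by
    by_contra hneg
    have : IsEmpty ι := ⟨fun x => hneg ((abs_nonneg _).trans (hgm 0 x))⟩
    have h1 := hu.tsum_eq
    simp at h1
  have hpos : Tendsto (fun m => ∑' x, max (u x - um m x) 0) atTop (𝓝 (∑' _x : ι, (0:ℝ))) := by
    refine tendsto_tsum_of_dominated_convergence (bound := u) hu.summable ?_ ?_
    · intro x
      have h1 : Tendsto (fun m => max (u x - um m x) 0) atTop (𝓝 (max (u x - u x) 0)) :=
        (tendsto_const_nhds.sub (hlim x)).max tendsto_const_nhds
      simpa using h1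
    · refine Eventually.of_forall fun m x => ?_
      rw [Real.norm_eq_abs, abs_of_nonneg (le_max_right _ _)]
      exact max_le (by linarith [hum0 m x]) (hu0 x)
  have hps : ∀ m, Summable fun x => max (u x - um m x) 0 := fun m =>
    Summable.of_nonneg_of_le (fun x => le_max_right _ _)
      (fun x => max_le (by linarith [hum0 m x]) (hu0 x)) hu.summable
  have habs : ∀ m x, |um m x - u x| = 2 * max (u x - um m x) 0 + (um m x - u x) := by
    intro m x
    rcases le_total (um m x) (u x) with h | h
    · rw [abs_of_nonpos (by linarith), max_eq_left (by linarith)]; ring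
    · rw [abs_of_nonneg (by linarith), max_eq_right (by linarith)]; ring
  have hds : ∀ m, HasSum (fun x => um m x - u x) 0 := fun m => by
    simpa using (hum m).sub hu
  have hasum : ∀ m, HasSum (fun x => |um m x - u x|) (2 * ∑' x, max (u x - um m x) 0) := fun m => by
    simp_rw [habs m]
    simpa using ((hps m).hasSum.mul_left 2).add (hds m)
  have hl1 : Tendsto (fun m => ∑' x, |um m x - u x|) atTop (𝓝 0) := by
    simp_rw [fun m => (hasum m).tsum_eq]
    simpa using hpos.const_mul 2
  have hbd : ∀ m x, ‖(um m x - u x) * gm m x‖ ≤ |um m x - u x| * C := fun m x => by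
    rw [norm_mul]
    exact mul_le_mul_of_nonneg_left (hgm m x) (abs_nonneg _)
  have h2 : Tendsto (fun m => ∑' x, (um m x - u x) * gm m x) atTop (𝓝 0) := by
    refine squeeze_zero_norm (a := fun m => (∑' x, |um m x - u x|) * C) ?_ (by
      simpa using hl1.mul_const C)
    intro m
    rw [← tsum_mul_right]
    exact tsum_of_norm_bounded ((hasum m).summable.mul_right C).hasSum (hbd m)
  have hub : ∀ m x, ‖u x * gm m x‖ ≤ u x * C := fun m x => by
    rw [norm_mul, Real.norm_of_nonneg (hu0 x)]
    exact mul_le_mul_of_nonneg_left (hgm m x) (hu0 x)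
  have h3 : Tendsto (fun m => ∑' x, u x * gm m x) atTop (𝓝 (∑' x, u x * g x)) :=
    tendsto_tsum_of_dominated_convergence (hu.summable.mul_right C)
      (fun x => (hg x).const_mul _) (Eventually.of_forall fun m x => hub m x)
  have h4 := h2.add h3
  rw [zero_add] at h4
  refine h4.congr fun m => ?_
  rw [← Summable.tsum_add (((hasum m).summable.mul_right C).of_norm_bounded (hbd m))
    ((hu.summable.mul_right C).of_norm_bounded (hub m))]
  congr 1
  funext x
  ring

/-- continuity of the integral against the product law -/
theorem pi_tendsto (x : X) {f : JA A → ℝ} (hfc : ContinuousOn f (jointSet G x)) {C : ℝ}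
    (hC : ∀ a, |f a| ≤ C) (ψ : StatProfile G) (ψm : ℕ → StatProfile G)
    (hconv : ∀ j, Tendsto (fun m => ψm m j) atTop (𝓝 (ψ j))) :
    Tendsto (fun m => ∫ a, f a ∂(piK G (ψm m) x)) atTop (𝓝 (∫ a, f a ∂(piK G ψ x))) := by
  have hcl : IsClosed (jointSet G x) :=
    isClosed_set_pi fun j _ => (G.hAs_cpt j x).isClosed
  have hsupp : ∀ ρ : StatProfile G, ∀ᵐ a ∂(piK G ρ x), a ∈ jointSet G x := by
    intro ρ
    refine (mem_ae_iff_prob_eq_one hcl.measurableSet).2 ?_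
    show (Measure.pi fun j => ((ρ j).1 x : Measure (A j))) (Set.univ.pi fun j => G.As j x) = 1
    rw [Measure.pi_pi]
    refine Finset.prod_eq_one fun j _ => ?_
    rw [← ProbabilityMeasure.ennreal_coeFn_eq_coeFn_toMeasure, (ρ j).2 x]; rfl
  obtain ⟨g, -, hg⟩ := BoundedContinuousFunction.exists_norm_eq_domRestrict_eq_of_closed
    (BoundedContinuousFunction.ofNormedAddCommGroup ((jointSet G x).domRestrict f)
      hfc.domRestrict C (fun a => hC a.1)) hcl
  have hgf : ∀ a ∈ jointSet G x, g a = f a := fun a ha => by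
    exact DFunLike.congr_fun hg ⟨a, ha⟩
  have hint : ∀ ρ : StatProfile G, ∫ a, f a ∂(piK G ρ x) = ∫ a, g a ∂(piK G ρ x) := fun ρ =>
    integral_congr_ae ((hsupp ρ).mono fun a ha => (hgf a ha).symm)
  simp_rw [hint]
  have hpt : Tendsto (fun m => ProbabilityMeasure.pi fun j => (ψm m j).1 x) atTop
      (𝓝 (ProbabilityMeasure.pi fun j => (ψ j).1 x)) := by
    refine (ProbabilityMeasure.continuous_pi.tendsto _).comp (tendsto_pi_nhds.2 fun j => ?_)
    exact (tendsto_pi_nhds.1 (tendsto_subtype_rng.1 (hconv j))) x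
  exact (ProbabilityMeasure.tendsto_iff_forall_integral_tendsto.1 hpt) g

theorem combine_self (ψ : StatProfile G) (i : Fin n) :
    combine G (ofStatAll G ψ) i (ofStat G i (ψ i)) = ofStatAll G ψ := by
  unfold combine
  exact Function.update_eq_self i (ofStatAll G ψ)

theorem combine_upd (φ : StatProfile G) (i : Fin n) (γ : Stat G i) :
    ofStatAll G (updStat G φ i γ) = combine G (ofStatAll G φ) i (ofStat G i γ) := by
  funext j
  unfold combine updStat ofStatAll
  by_cases hj : j = i
  · subst hj; simp
  · simp [Function.update_of_ne hj]

/-- state distribution at time `t` -/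
noncomputable def mX (ψ : StatProfile G) (t : ℕ) : Measure X :=
  (histMeas G G.η (ofStatAll G ψ) t).map (lastState X (JA A) t)

theorem mX_eq (ψ : StatProfile G) (i : Fin n) (t : ℕ) :
    mX G ψ t = (SM G ψ (ofStat G i (ψ i)) t).map Prod.fst := by
  rw [SM_map_fst, combine_self]; rfl

theorem WSM_stat (ψ : StatProfile G) (i : Fin n) (t : ℕ) :
    (SM G ψ (ofStat G i (ψ i)) t).bind (WK G ψ i) = mX G ψ t ⊗ₘ piK G ψ := by
  have hp : IsProbabilityMeasure (mX G ψ t) := by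
    rw [mX_eq G ψ i]
    exact Measure.isProbabilityMeasure_map measurable_fst.aemeasurable
  apply Measure.ext_of_lintegral
  intro g hg
  rw [Measure.lintegral_compProd hg]
  unfold mX
  rw [lintegral_map (hg.lintegral_kernel_prod_right') (measurable_lastState X (JA A) t), WSM_eq,
    Measure.lintegral_bind (xaK G ψ _ t).measurable.aemeasurable hg.aemeasurable, combine_self]
  apply lintegral_congr
  intro h
  rw [xaK_eq, lintegral_map hg measurable_prodMk_left, combine_self]
  rfl

theorem mX_prob (i : Fin n) (ψ : StatProfile G) (t : ℕ) : IsProbabilityMeasure (mX G ψ t) := by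
  rw [mX_eq G ψ i]
  exact Measure.isProbabilityMeasure_map measurable_fst.aemeasurable

theorem mX_int (i : Fin n) (ψ : StatProfile G) (t : ℕ) {f : X → JA A → ℝ}
    (hf : ∀ x, Measurable (f x)) {C : ℝ} (hC : ∀ x a, |f x a| ≤ C) :
    ∫ q, f q.1 q.2 ∂(mX G ψ t ⊗ₘ piK G ψ) =
      ∑' x, (mX G ψ t).real {x} * ∫ a, f x a ∂(piK G ψ x) := by
  have hp := mX_prob G i ψ t
  have hm : Measurable fun q : X × JA A => f q.1 q.2 := measurable_from_prod_countable_right hf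
  have hi := integrable_bdd (mX G ψ t ⊗ₘ piK G ψ) hm (fun q => hC q.1 q.2)
  have hii : Integrable (fun x => ∫ a, f x a ∂(piK G ψ x)) (mX G ψ t) := by
    refine integrable_bdd (C := C) _ Measurable.of_discrete fun x => ?_
    have := norm_integral_le_of_norm_le_const (μ := piK G ψ x) (f := f x) (ae_of_all _ (hC x))
    simpa using this
  rw [Measure.integral_compProd hi, integral_countable hii]
  simp only [smul_eq_mul]

theorem mX_hasSum (i : Fin n) (ψ : StatProfile G) (t : ℕ) :
    HasSum (fun x => (mX G ψ t).real {x}) 1 := by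
  have hp := mX_prob G i ψ t
  have h1 : Summable fun x => (mX G ψ t).real {x} := by
    refine ENNReal.summable_toReal ?_
    have := Measure.tsum_indicator_apply_singleton (mX G ψ t) Set.univ MeasurableSet.univ
    simp at this
    rw [this]; simp
  have h2 := integral_countable (μ := mX G ψ t) (f := fun _ => (1:ℝ)) (integrable_const _)
  simp at h2
  rw [h2]
  exact h1.hasSum

theorem mX_succ (i : Fin n) (ψ : StatProfile G) (t : ℕ) (y : X) :
    (mX G ψ (t+1)).real {y} = ∫ q, (G.p q.1 q.2).real {y} ∂(mX G ψ t ⊗ₘ piK G ψ) := by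
  have hp := mX_prob G i ψ t
  rw [mX_eq G ψ i, SM_succ, WSM_stat, measureReal_def,
    Measure.bind_apply (MeasurableSet.singleton y) (pK G).measurable.aemeasurable]
  rw [← integral_toReal]
  · rfl
  · exact (Kernel.measurable_coe (pK G) (MeasurableSet.singleton y)).aemeasurable
  · exact ae_of_all _ fun q => measure_lt_top _ _

theorem stage_tendsto (i : Fin n) (ψ : StatProfile G) (ψm : ℕ → StatProfile G)
    (hconv : ∀ j, Tendsto (fun m => ψm m j) atTop (𝓝 (ψ j))) (t : ℕ)
    (hX : ∀ x, Tendsto (fun m => (mX G (ψm m) t).real {x}) atTop (𝓝 ((mX G ψ t).real {x})))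
    {f : X → JA A → ℝ} (hf : ∀ x, Measurable (f x)) {C : ℝ} (hC : ∀ x a, |f x a| ≤ C)
    (hfc : ∀ x, ContinuousOn (f x) (jointSet G x)) :
    Tendsto (fun m => ∫ q, f q.1 q.2 ∂(mX G (ψm m) t ⊗ₘ piK G (ψm m))) atTop
      (𝓝 (∫ q, f q.1 q.2 ∂(mX G ψ t ⊗ₘ piK G ψ))) := by
  simp_rw [fun ρ => mX_int G i ρ t hf hC]
  refine scheffe _ _ (fun x => measureReal_nonneg) (fun m x => measureReal_nonneg)
    (mX_hasSum G i ψ t) (fun m => mX_hasSum G i (ψm m) t) hX _ _ (C := C) ?_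
    (fun x => pi_tendsto G x (hfc x) (hC x) ψ ψm hconv)
  intro m x
  have := norm_integral_le_of_norm_le_const (μ := piK G (ψm m) x) (f := f x) (ae_of_all _ (hC x))
  simpa using this

theorem mX_tendsto (hA : AssumptionA1 G) (i : Fin n) (ψ : StatProfile G) (ψm : ℕ → StatProfile G)
    (hconv : ∀ j, Tendsto (fun m => ψm m j) atTop (𝓝 (ψ j))) (t : ℕ) :
    ∀ x, Tendsto (fun m => (mX G (ψm m) t).real {x}) atTop (𝓝 ((mX G ψ t).real {x})) := by
  induction t with
  | zero =>
    intro x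
    have : ∀ ρ : StatProfile G, mX G ρ 0 = G.η := fun ρ => by
      rw [mX_eq G ρ i, SM_zero]
    simp_rw [this]
    exact tendsto_const_nhds
  | succ t ih =>
    intro y
    simp_rw [fun ρ => mX_succ G i ρ t y]
    refine stage_tendsto G i ψ ψm hconv t ih (f := fun x a => (G.p x a).real {y}) (C := 1)
      (fun x => (G.hpm x y).ennreal_toReal) ?_ ?_
    · intro x a
      have := G.hp x a
      rw [abs_of_nonneg measureReal_nonneg]
      exact measureReal_le_one
    · intro x
      have hne : ∀ a, G.p x a {y} ≠ ∞ := fun a => by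
        have := G.hp x a
        exact measure_ne_top _ _
      exact fun a ha => (ENNReal.tendsto_toReal (hne a)).comp (hA x y a ha)

theorem Jfun_tendsto (hA : AssumptionA1 G) (i : Fin n) (ψ : StatProfile G)
    (ψm : ℕ → StatProfile G)
    (hconv : ∀ j, Tendsto (fun m => ψm m j) atTop (𝓝 (ψ j)))
    {f : X → JA A → ℝ} (hf : ∀ x, Measurable (f x)) {C : ℝ} (hC : ∀ x a, |f x a| ≤ C)
    (hfc : ∀ x, ContinuousOn (f x) (jointSet G x)) :
    Tendsto (fun m => Jfun G G.η f (ofStatAll G (ψm m))) atTop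
      (𝓝 (Jfun G G.η f (ofStatAll G ψ))) := by
  have hst : ∀ (ρ : StatProfile G) (t : ℕ), stageExp G G.η (ofStatAll G ρ) t f =
      ∫ q, f q.1 q.2 ∂(mX G ρ t ⊗ₘ piK G ρ) := fun ρ t => by
    have := stageExp_eq G ρ (ofStat G i (ρ i)) t hf hC
    rwa [combine_self, WSM_stat] at this
  unfold Jfun
  refine Tendsto.const_mul _ ?_
  simp_rw [hst]
  refine tendsto_tsum_of_dominated_convergence (bound := fun t => G.α ^ t * C)
    ((summable_geometric_of_lt_one G.hα0.le G.hα1).mul_right C) ?_ ?_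
  · intro t
    exact (stage_tendsto G i ψ ψm hconv t (mX_tendsto G hA i ψ ψm hconv t) hf hC hfc).const_mul _
  · refine Eventually.of_forall fun m t => ?_
    have hp := mX_prob G i (ψm m) t
    rw [norm_mul, Real.norm_of_nonneg (pow_nonneg G.hα0.le t)]
    refine mul_le_mul_of_nonneg_left ?_ (pow_nonneg G.hα0.le t)
    have := norm_integral_le_of_norm_le_const (μ := mX G (ψm m) t ⊗ₘ piK G (ψm m))
      (f := fun q => f q.1 q.2) (ae_of_all _ fun q => hC q.1 q.2)
    simpa using this

theorem J_mix (φ : StatProfile G) {i : Fin n} (σ τ₁ τ₂ : Strategy G i)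
    {e : ℝ} (he0 : 0 ≤ e) (he1 : e ≤ 1)
    (h : occ2 G φ σ = ENNReal.ofReal (1 - e) • occ2 G φ τ₁ + ENNReal.ofReal e • occ2 G φ τ₂)
    {f : X → JA A → ℝ} (hf : ∀ x, Measurable (f x)) {C : ℝ} (hC : ∀ x a, |f x a| ≤ C) :
    Jfun G G.η f (combine G (ofStatAll G φ) i σ) =
      (1 - e) * Jfun G G.η f (combine G (ofStatAll G φ) i τ₁)
      + e * Jfun G G.η f (combine G (ofStatAll G φ) i τ₂) := by
  have hm : Measurable fun q : X × JA A => f q.1 q.2 := measurable_from_prod_countable_right hf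
  rw [Jfun_eq G φ σ hf hC, Jfun_eq G φ τ₁ hf hC, Jfun_eq G φ τ₂ hf hC, h, Measure.comp_add,
    Measure.comp_smul, Measure.comp_smul, integral_add_measure, integral_smul_measure,
    integral_smul_measure, ENNReal.toReal_ofReal (by linarith), ENNReal.toReal_ofReal he0]
  · rfl
  · exact (integrable_bdd _ hm (fun q => hC q.1 q.2)).smul_measure ENNReal.ofReal_ne_top
  · exact (integrable_bdd _ hm (fun q => hC q.1 q.2)).smul_measure ENNReal.ofReal_ne_top

/-- a feasible stationary strategy exists at every profile -/
theorem fallback_exists (hC : AssumptionC G)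
    (hb : ∀ i (ℓ : Fin (l + 1)), ℓ ≠ 0 → ∃ C : ℝ, ∀ x a, |G.c i ℓ x a| ≤ C)
    (hη : AssumptionD G) (i : Fin n) (φ : StatProfile G) :
    ∃ γ : Stat G i, Feas G i (ofStatAll G (updStat G φ i γ)) := by
  obtain ⟨π, hπ⟩ := hC φ i
  obtain ⟨γ, hγ⟩ := mix_exists G hη φ π π (e := 0) le_rfl zero_le_one
  refine ⟨γ, fun ℓ hℓ => ?_⟩
  obtain ⟨C, hCb⟩ := hb i ℓ hℓ
  rw [combine_upd]
  have h1 := J_mix G φ _ _ _ le_rfl zero_le_one hγ (G.hc i ℓ) hCb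
  have h2 := hπ ℓ hℓ
  unfold J at h2 ⊢
  rw [h1]
  linarith

/-- Lemma A2. -/
theorem stmt17 (hA : AssumptionA G) (hC : AssumptionC G)
    (hb : ∀ i (ℓ : Fin (l + 1)), ℓ ≠ 0 → ∃ C : ℝ, ∀ x a, |G.c i ℓ x a| ≤ C)
    (hη : AssumptionD G) (i : Fin n)
    (φ : StatProfile G) (φm : ℕ → StatProfile G)
    (hconv : ∀ j, j ≠ i → Tendsto (fun m => φm m j) atTop (𝓝 (φ j)))
    (γ : Stat G i) (hγ : Feas G i (ofStatAll G (updStat G φ i γ))) :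
    ∃ γm : ℕ → Stat G i,
      (∀ m : ℕ, Feas G i (ofStatAll G (updStat G (φm m) i (γm m)))) ∧
      Tendsto γm atTop (𝓝 γ) := by
  classical
  obtain ⟨π, hπ⟩ := hC φ i
  have he0 : ∀ k : ℕ, (0:ℝ) < 1 / ((k:ℝ) + 1) := fun k => by positivity
  have he1 : ∀ k : ℕ, 1 / ((k:ℝ) + 1) ≤ 1 := fun k => by
    rw [div_le_one (by positivity)]
    have : (0:ℝ) ≤ k := Nat.cast_nonneg k
    linarith
  choose γk hγk using fun k : ℕ =>
    mix_exists G hη φ (ofStat G i γ) π (e := 1 / ((k:ℝ) + 1)) (he0 k).le (he1 k)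
  have hγlim : Tendsto γk atTop (𝓝 γ) :=
    mix_tendsto G hη φ γ π (fun k : ℕ => 1 / ((k:ℝ) + 1)) (fun k => (he0 k).le) he1
      tendsto_one_div_add_atTop_nhds_zero_nat γk hγk
  have hstrict : ∀ k (ℓ : Fin (l + 1)), ℓ ≠ 0 →
      J G i ℓ (ofStatAll G (updStat G φ i (γk k))) < G.κ i ℓ := by
    intro k ℓ hℓ
    obtain ⟨C, hCb⟩ := hb i ℓ hℓ
    have h1 := J_mix G φ _ _ _ (he0 k).le (he1 k) (hγk k) (G.hc i ℓ) hCb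
    have h2 := hπ ℓ hℓ
    have h3 := hγ ℓ hℓ
    rw [combine_upd] at h3 ⊢
    unfold J at h2 h3 ⊢
    rw [h1]
    have h4 := mul_lt_mul_of_pos_left h2 (he0 k)
    have h5 := mul_le_mul_of_nonneg_left h3 (sub_nonneg.2 (he1 k))
    linarith
  have hev : ∀ k, ∀ᶠ m in atTop, Feas G i (ofStatAll G (updStat G (φm m) i (γk k))) := by
    intro k
    refine eventually_all.2 fun ℓ => ?_
    by_cases hℓ : ℓ = 0
    · exact Eventually.of_forall fun m h => absurd hℓ h
    · obtain ⟨C, hCb⟩ := hb i ℓ hℓ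
      have ht := Jfun_tendsto G hA.1 i (updStat G φ i (γk k))
        (fun m => updStat G (φm m) i (γk k)) (fun j => by
          by_cases hj : j = i
          · subst hj
            simp only [updStat, Function.update_self]
            exact tendsto_const_nhds
          · simp only [updStat, Function.update_of_ne hj]
            exact hconv j hj) (G.hc i ℓ) hCb (hA.2 i ℓ)
      filter_upwards [ht.eventually_lt_const (hstrict k ℓ hℓ)] with m hm _
      exact hm.le
  choose fb hfb using fun m => fallback_exists G hC hb hη i (φm m)
  let P : ℕ → ℕ → Prop := fun m k => Feas G i (ofStatAll G (updStat G (φm m) i (γk k)))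
  let K : ℕ → ℕ := fun m => Nat.findGreatest (P m) m
  refine ⟨fun m => if P m (K m) then γk (K m) else fb m, fun m => ?_, ?_⟩
  · show Feas G i (ofStatAll G (updStat G (φm m) i (if P m (K m) then γk (K m) else fb m)))
    split_ifs with h
    · exact h
    · exact hfb m
  · have hK : Tendsto K atTop atTop := by
      refine tendsto_atTop.2 fun k => ?_
      filter_upwards [hev k, eventually_ge_atTop k] with m hm hkm
      exact Nat.le_findGreatest hkm hm
    refine (hγlim.comp hK).congr' ?_
    filter_upwards [hev 0] with m hm
    have : P m (K m) := Nat.findGreatest_spec (P := P m) (Nat.zero_le m) hm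
    simp [this]


end CSGame
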